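/- Let N, K, n be natural numbers with K ≤ n ≤ N and K ≤ N. Then for every nonzero complex number z, the probability-generating function of the hypergeometric distribution satisfies ∑_{k=0}^{n} (C(K,k)·C(N−K,n−k)/C(N,n))·z^k = (n!·(N−K)!)/(N!·(n−K)!) · z^K · ∑_{j=0}^{min(N−n,K)} ((n−N)_j·(−K)_j)/((n−K+1)_j · j!) · z^{−j}; that is, this formula is valid on the full range K ≤ n ≤ N (extending the range K ≤ N/2, n ≥ N/2). -/

import Mathlib

open Finset Nat

theorem ascPochhammer_eval_neg_natCast (a j : ℕ) (h : j ≤ a) :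
    (ascPochhammer ℂ j).eval (-(a : ℂ)) = (-1) ^ j * ((a ! : ℂ) / ((a - j)! : ℂ)) := by
  rw [ascPochhammer_eval_neg_eq_descPochhammer, descPochhammer_eval_eq_descFactorial,
    ← Nat.factorial_mul_descFactorial h]
  have : ((a - j)! : ℂ) ≠ 0 := by exact_mod_cast Nat.factorial_ne_zero _
  push_cast
  field_simp

theorem ascPochhammer_eval_natCast_add_one (m j : ℕ) :
    (ascPochhammer ℂ j).eval ((m : ℂ) + 1) = ((m + j)! : ℂ) / (m ! : ℂ) := by
  have h : (m ! : ℂ) ≠ 0 := by exact_mod_cast Nat.factorial_ne_zero _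
  rw [← Nat.factorial_mul_ascFactorial, ← Nat.cast_succ, ← ascPochhammer_eval_cast,
    ascPochhammer_nat_eq_ascFactorial]
  push_cast
  field_simp

theorem hypergeometric_pmf_reflect (K m r j : ℕ) (hK : j ≤ K) (hr : j ≤ r) :
    (K.choose (K - j) : ℂ) * ((m + r).choose (m + j) : ℂ) / ((K + m + r).choose (K + m) : ℂ)
    = ((K + m)! : ℂ) * ((m + r)! : ℂ) / (((K + m + r)! : ℂ) * (m ! : ℂ)) *
      (((ascPochhammer ℂ j).eval (-(r : ℂ)) * (ascPochhammer ℂ j).eval (-(K : ℂ))) /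
        ((ascPochhammer ℂ j).eval ((m : ℂ) + 1) * (j ! : ℂ))) := by
  have hf (a : ℕ) : (a ! : ℂ) ≠ 0 := by exact_mod_cast Nat.factorial_ne_zero a
  rw [ascPochhammer_eval_neg_natCast r j hr, ascPochhammer_eval_neg_natCast K j hK,
    ascPochhammer_eval_natCast_add_one, Nat.choose_symm hK, Nat.cast_choose ℂ hK,
    Nat.cast_choose ℂ (Nat.add_le_add_left hr m), Nat.cast_choose ℂ (Nat.le_add_right (K + m) r),
    Nat.add_sub_add_left, Nat.add_sub_cancel_left]
  have hs : ((-1 : ℂ) ^ j) * (-1) ^ j = 1 := by rw [← mul_pow]; simp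
  have := hf K
  have := hf (K - j)
  have := hf j
  have := hf (m + r)
  have := hf (m + j)
  have := hf (r - j)
  have := hf (K + m + r)
  have := hf (K + m)
  have := hf r
  have := hf m
  rw [mul_mul_mul_comm ((-1 : ℂ) ^ j), hs]
  field_simp

theorem hypergeometric_pgf_symmetric_form_a_extended (N K n : ℕ) (hKn : K ≤ n) (hnN : n ≤ N)
    (hKN : K ≤ N) (z : ℂ) (hz : z ≠ 0) :
    ∑ k ∈ Finset.range (n + 1),
        ((K.choose k : ℂ) * ((N - K).choose (n - k) : ℂ) / (N.choose n : ℂ)) * z ^ k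
    = (n ! : ℂ) * ((N - K)! : ℂ) / ((N ! : ℂ) * ((n - K)! : ℂ)) * z ^ K *
      ∑ j ∈ Finset.range (min (N - n) K + 1),
        ((ascPochhammer ℂ j).eval ((n : ℂ) - (N : ℂ)) * (ascPochhammer ℂ j).eval (-(K : ℂ))) /
          ((ascPochhammer ℂ j).eval ((n : ℂ) - (K : ℂ) + 1) * (j ! : ℂ)) *
          z ^ (-(j : ℤ)) := by
  obtain ⟨m, rfl⟩ := Nat.exists_eq_add_of_le hKn
  obtain ⟨r, rfl⟩ := Nat.exists_eq_add_of_le hnN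
  have e1 : K + m + r - K = m + r := by omega
  have e2 : K + m + r - (K + m) = r := by omega
  have e3 : K + m - K = m := by omega
  have e4 : ((K + m : ℕ) : ℂ) - ((K + m + r : ℕ) : ℂ) = -(r : ℂ) := by push_cast; ring
  have e5 : ((K + m : ℕ) : ℂ) - (K : ℂ) + 1 = (m : ℂ) + 1 := by push_cast; ring
  rw [e1, e2, e3, e4, e5]
  rw [← Finset.sum_subset (s₁ := Finset.range (K + 1)) (Finset.range_mono (by omega)),
    ← Finset.sum_range_reflect,
    ← Finset.sum_subset (s₁ := Finset.range (min r K + 1)) (Finset.range_mono (by omega)),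
    Finset.mul_sum]
  · refine Finset.sum_congr rfl fun j hj => ?_
    rw [Finset.mem_range] at hj
    have hK : j ≤ K := by omega
    have hr : j ≤ r := by omega
    have hsub : K + 1 - 1 - j = K - j := by omega
    have hadd : K + m - (K - j) = m + j := by omega
    have hpow : z ^ (K - j) = z ^ K * z ^ (-(j : ℤ)) := by
      rw [pow_sub₀ z hz hK, zpow_neg, zpow_natCast]
    rw [hsub, hadd, hypergeometric_pmf_reflect K m r j hK hr, hpow]
    ring
  · intro j hj hj'
    rw [Finset.mem_range] at hj hj'
    rw [Nat.choose_eq_zero_of_lt (show m + r < K + m - (K + 1 - 1 - j) by omega)]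
    simp
  · intro k _ hk
    rw [Finset.mem_range] at hk
    rw [Nat.choose_eq_zero_of_lt (show K < k by omega)]
    simp
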